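/- Assume P[y²] < ∞, and set ȳ(A) = P[y 1_A(x)]/P(A) if P(A) > 0 and ȳ(A) = 0 otherwise. Then the following variance decomposition holds: P[y²] = ∫_𝒜 (P[y 1_A(x)]² / P(A)) ν(dA) + ∫_𝒜 P[(y − ȳ(A))² 1_A(x)] ν(dA), where the first integrand is taken to be 0 when P(A) = 0. In particular ∫_𝒜 P[y 1_A(x)]² / P(A) ν(dA) ≤ P[y²]. -/

import Mathlib

open MeasureTheory
open scoped ENNReal RealInnerProductSpace

noncomputable section

/-- Points of the unit cube `[0,1]^p`. -/
abbrev Pt (p : ℕ) : Type := Fin p → Set.Icc (0 : ℝ) 1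

/-- Hyperrectangles `∏_j [a_j, b_j⟩` of `[0,1]^p`, encoded by the pair of endpoints
`(a, b)` with `0 ≤ a_j < b_j ≤ 1`, viewed as a subtype of `(Fin p → ℝ) × (Fin p → ℝ)`
with the inherited sup metric (which is exactly the metric `ρ`) and its Borel σ-algebra. -/
abbrev HRect (p : ℕ) : Type :=
  {ab : (Fin p → ℝ) × (Fin p → ℝ) // ∀ j, 0 ≤ ab.1 j ∧ ab.1 j < ab.2 j ∧ ab.2 j ≤ 1}

/-- Membership `z ∈ [a, b⟩`: `a_j ≤ z_j` and (`z_j < b_j`, or `b_j = 1` in which case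
`z_j ≤ b_j` holds automatically). -/
def memRect {p : ℕ} (z : Pt p) (A : HRect p) : Prop :=
  ∀ j, A.1.1 j ≤ (z j : ℝ) ∧ ((z j : ℝ) < A.1.2 j ∨ A.1.2 j = 1)

/-- The indicator `1_A(z)`. -/
def ind {p : ℕ} (z : Pt p) (A : HRect p) : ℝ :=
  haveI := Classical.propDecidable (memRect z A)
  if memRect z A then 1 else 0

/-- The kernel `k0(z,z') = ∫ 1_A(z) 1_A(z') ν(dA)`. -/
def k0 {p : ℕ} (ν : Measure (HRect p)) (z z' : Pt p) : ℝ :=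
  ∫ A, ind z A * ind z' A ∂ν

/-- `P(A)`: the measure of the hyperrectangle `A` under the first marginal of `P`. -/
def PA {p : ℕ} (P : Measure (Pt p × ℝ)) (A : HRect p) : ℝ :=
  (P.fst {z | memRect z A}).toReal

/-- `α_P²(A) = 1/P(A)` if `P(A) > 0`, and `1` otherwise. -/
def alphaSq {p : ℕ} (P : Measure (Pt p × ℝ)) (A : HRect p) : ℝ :=
  haveI := Classical.propDecidable (0 < PA P A)
  if 0 < PA P A then 1 / PA P A else 1

/-- The kernel `k(z,z') = ∫ α_P²(A) 1_A(z) 1_A(z') ν(dA) ∈ [0,∞]`. -/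
def kk {p : ℕ} (P : Measure (Pt p × ℝ)) (ν : Measure (HRect p)) (z z' : Pt p) : ℝ≥0∞ :=
  ∫⁻ A, ENNReal.ofReal (alphaSq P A * ind z A * ind z' A) ∂ν


/-- `P[y 1_A(x)]`. -/
def numer {p : ℕ} (P : Measure (Pt p × ℝ)) (A : HRect p) : ℝ :=
  ∫ w : Pt p × ℝ, w.2 * ind w.1 A ∂P

theorem measurableSet_memRect (p : ℕ) :
    MeasurableSet {q : Pt p × HRect p | memRect q.1 q.2} := by
  have hz (j : Fin p) : Measurable fun q : Pt p × HRect p => (q.1 j : ℝ) :=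
    measurable_subtype_coe.comp ((measurable_pi_apply j).comp measurable_fst)
  have ha (j : Fin p) : Measurable fun q : Pt p × HRect p => q.2.1.1 j :=
    (measurable_pi_apply j).comp
      (measurable_fst.comp (measurable_subtype_coe.comp measurable_snd))
  have hb (j : Fin p) : Measurable fun q : Pt p × HRect p => q.2.1.2 j :=
    (measurable_pi_apply j).comp
      (measurable_snd.comp (measurable_subtype_coe.comp measurable_snd))
  simp only [memRect, Set.ofPred_forall]
  exact MeasurableSet.iInter fun j => (measurableSet_le (ha j) (hz j)).inter
    ((measurableSet_lt (hz j) (hb j)).union (measurableSet_eq_fun (hb j) measurable_const))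

theorem measurable_ind (p : ℕ) : Measurable fun q : Pt p × HRect p => ind q.1 q.2 := by
  classical
  unfold ind
  exact Measurable.ite (measurableSet_memRect p) measurable_const measurable_const

theorem ind_nonneg {p : ℕ} (z : Pt p) (A : HRect p) : 0 ≤ ind z A := by
  unfold ind; split_ifs <;> norm_num

theorem ind_le_one {p : ℕ} (z : Pt p) (A : HRect p) : ind z A ≤ 1 := by
  unfold ind; split_ifs <;> norm_num

theorem measurable_ind_fst {p : ℕ} (A : HRect p) :
    Measurable fun w : Pt p × ℝ => ind w.1 A :=
  (measurable_ind p).comp (measurable_fst.prodMk measurable_const)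

theorem integrable_mul_ind {p : ℕ} {P : Measure (Pt p × ℝ)} {f : Pt p × ℝ → ℝ}
    (hf : Integrable f P) (A : HRect p) : Integrable (fun w => f w * ind w.1 A) P :=
  hf.mul_bdd (c := 1) (measurable_ind_fst A).aestronglyMeasurable
    (.of_forall fun w => by
      simpa [abs_of_nonneg (ind_nonneg w.1 A)] using ind_le_one w.1 A)

theorem PA_eq_integral_ind {p : ℕ} (P : Measure (Pt p × ℝ)) (A : HRect p) :
    PA P A = ∫ w, ind w.1 A ∂P := by
  have hs : MeasurableSet {z : Pt p | memRect z A} :=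
    (measurableSet_memRect p).preimage (measurable_id.prodMk measurable_const)
  have h : (fun w : Pt p × ℝ => ind w.1 A) =
      (Prod.fst ⁻¹' {z : Pt p | memRect z A}).indicator 1 := by
    classical
    ext w
    simp [ind, Set.indicator_apply]
  rw [h, integral_indicator_one (measurable_fst hs), PA, Measure.fst_apply hs]
  rfl

theorem measurable_integral_mul_ind {p : ℕ} (P : Measure (Pt p × ℝ)) [SFinite P]
    {f : Pt p × ℝ → ℝ} (hf : Measurable f) :
    Measurable fun A : HRect p => ∫ w, f w * ind w.1 A ∂P := by
  have h : Measurable fun q : HRect p × (Pt p × ℝ) => f q.2 * ind q.2.1 q.1 :=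
    (hf.comp measurable_snd).mul ((measurable_ind p).comp
      ((measurable_fst.comp measurable_snd).prodMk measurable_fst))
  exact h.stronglyMeasurable.integral_prod_right.measurable

/-- The variance decomposition on a single hyperrectangle. -/
theorem integral_sq_mul_ind_eq {p : ℕ} (P : Measure (Pt p × ℝ)) [IsProbabilityMeasure P]
    (hy2 : Integrable (fun w : Pt p × ℝ => w.2 ^ 2) P) (A : HRect p) :
    ∫ w, w.2 ^ 2 * ind w.1 A ∂P = (numer P A) ^ 2 / PA P A
      + ∫ w, (w.2 - numer P A / PA P A) ^ 2 * ind w.1 A ∂P := by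
  have hy : Integrable (fun w : Pt p × ℝ => w.2) P :=
    ((memLp_two_iff_integrable_sq measurable_snd.aestronglyMeasurable).2 hy2).integrable
      one_le_two
  have h0 := integrable_mul_ind (integrable_const (1 : ℝ) (μ := P)) A
  have h1 := integrable_mul_ind hy A
  have h2 := integrable_mul_ind hy2 A
  generalize hc : numer P A / PA P A = c
  have hsub : Integrable
      (fun w : Pt p × ℝ => w.2 ^ 2 * ind w.1 A - 2 * c * (w.2 * ind w.1 A)) P :=
    h2.sub (h1.const_mul _)
  have hexp : ∫ w, (w.2 - c) ^ 2 * ind w.1 A ∂P =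
      ∫ w, w.2 ^ 2 * ind w.1 A ∂P - 2 * c * numer P A + c ^ 2 * PA P A := by
    rw [PA_eq_integral_ind, numer, ← integral_const_mul, ← integral_const_mul,
      ← integral_sub h2 (h1.const_mul _), ← integral_add hsub]
    · exact integral_congr_ae (.of_forall fun w => by simp only; ring)
    · simpa using h0.const_mul (c ^ 2)
  rw [hexp, ← hc]
  rcases eq_or_ne (PA P A) 0 with h | h
  · simp [h]
  · field_simp
    ring

theorem integrable_sq_mul_ind_prod {p : ℕ} (ν : Measure (HRect p)) [IsFiniteMeasure ν]
    (P : Measure (Pt p × ℝ)) [IsProbabilityMeasure P]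
    (hy2 : Integrable (fun w : Pt p × ℝ => w.2 ^ 2) P) :
    Integrable (fun q : (Pt p × ℝ) × HRect p => q.1.2 ^ 2 * ind q.1.1 q.2) (P.prod ν) :=
  (hy2.comp_fst ν).mul_bdd (c := 1)
    ((measurable_ind p).comp
      ((measurable_fst.comp measurable_fst).prodMk measurable_snd)).aestronglyMeasurable
    (.of_forall fun q => by
      simpa [abs_of_nonneg (ind_nonneg q.1.1 q.2)] using ind_le_one q.1.1 q.2)

/-- variance decomposition: if `P[y²] < ∞` then
`P[y²] = ∫ P[y 1_A(x)]²/P(A) ν(dA) + ∫ P[(y − ȳ(A))² 1_A(x)] ν(dA)`, where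
`ȳ(A) = P[y 1_A(x)]/P(A)` (`= 0` when `P(A) = 0`, by Lean's division-by-zero convention,
which also makes the first integrand `0` when `P(A) = 0`).  In particular the first
integral is at most `P[y²]`. -/
theorem stmt7 {p : ℕ} (ν : Measure (HRect p)) [IsFiniteMeasure ν]
    (hnorm : ∀ z : Pt p, ∫ A, ind z A ∂ν = 1)
    (P : Measure (Pt p × ℝ)) [IsProbabilityMeasure P]
    (hy2 : Integrable (fun w : Pt p × ℝ => w.2 ^ 2) P) :
    ((∫ w : Pt p × ℝ, w.2 ^ 2 ∂P)
        = (∫ A, (numer P A) ^ 2 / PA P A ∂ν)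
          + ∫ A, (∫ w : Pt p × ℝ, (w.2 - numer P A / PA P A) ^ 2 * ind w.1 A ∂P) ∂ν) ∧
    (∫ A, (numer P A) ^ 2 / PA P A ∂ν) ≤ ∫ w : Pt p × ℝ, w.2 ^ 2 ∂P := by
  have hprod := integrable_sq_mul_ind_prod ν P hy2
  have htotal : ∫ w : Pt p × ℝ, w.2 ^ 2 ∂P = ∫ A, ∫ w, w.2 ^ 2 * ind w.1 A ∂P ∂ν := by
    rw [← integral_integral_swap (f := fun (w : Pt p × ℝ) A => w.2 ^ 2 * ind w.1 A) hprod]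
    simp [integral_const_mul, hnorm]
  have hint : Integrable (fun A => ∫ w, w.2 ^ 2 * ind w.1 A ∂P) ν := hprod.integral_prod_right
  have hres_nonneg (A : HRect p) :
      0 ≤ ∫ w : Pt p × ℝ, (w.2 - numer P A / PA P A) ^ 2 * ind w.1 A ∂P :=
    integral_nonneg fun w => mul_nonneg (sq_nonneg _) (ind_nonneg _ _)
  have hexpl_nonneg (A : HRect p) : 0 ≤ (numer P A) ^ 2 / PA P A :=
    div_nonneg (sq_nonneg _) ENNReal.toReal_nonneg
  have hmeas : Measurable fun A => (numer P A) ^ 2 / PA P A := by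
    have hPA : Measurable fun A => PA P A := by
      simpa [PA_eq_integral_ind] using
        measurable_integral_mul_ind P (measurable_const (a := (1 : ℝ)))
    exact ((measurable_integral_mul_ind P measurable_snd).pow_const 2).div hPA
  have hexpl : Integrable (fun A => (numer P A) ^ 2 / PA P A) ν :=
    hint.mono' hmeas.aestronglyMeasurable (.of_forall fun A => by
      rw [Real.norm_of_nonneg (hexpl_nonneg A), integral_sq_mul_ind_eq P hy2 A]
      exact le_add_of_nonneg_right (hres_nonneg A))
  have hres : Integrable
      (fun A => ∫ w : Pt p × ℝ, (w.2 - numer P A / PA P A) ^ 2 * ind w.1 A ∂P) ν :=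
    (hint.sub hexpl).congr (.of_forall fun A => by
      simp only [Pi.sub_apply, integral_sq_mul_ind_eq P hy2 A, add_sub_cancel_left])
  have hdecomp : (∫ w : Pt p × ℝ, w.2 ^ 2 ∂P)
      = (∫ A, (numer P A) ^ 2 / PA P A ∂ν)
        + ∫ A, (∫ w : Pt p × ℝ, (w.2 - numer P A / PA P A) ^ 2 * ind w.1 A ∂P) ∂ν := by
    rw [htotal, ← integral_add hexpl hres]
    exact integral_congr_ae (.of_forall fun A => integral_sq_mul_ind_eq P hy2 A)
  exact ⟨hdecomp, hdecomp ▸ le_add_of_nonneg_right (integral_nonneg hres_nonneg)⟩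

end
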